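/- Under the su(N) generator hypotheses, the Dirac matrices in the Dirac representation, and the Grassmann setup, the pseudoscalar Fierz identity for U(N) fermions holds: Σ_{a : Fin (N^2−1)} ⟪γ5, T a⟫ * ⟪γ5, T a⟫ = −(1/8) • ⟪1⟫ * ⟪1⟫ + (1/8) • Σ_{μ} ε μ • ⟪γ μ⟫ * ⟪γ μ⟫ − (1/16) • Σ_{μ,ν} ε μ · ε ν • ⟪σ μ ν⟫ * ⟪σ μ ν⟫ − (1/8) • Σ_{μ} ε μ • ⟪γ5 * γ μ⟫ * ⟪γ5 * γ μ⟫ − ((N+4)/(8·N)) • ⟪γ5⟫ * ⟪γ5⟫, where μ, ν range over Fin 4. -/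

import Mathlib

noncomputable section

open Complex Matrix

/-- The Dirac γ-matrices in the Dirac representation. -/
def γm : Fin 4 → Matrix (Fin 4) (Fin 4) ℂ :=
  ![!![1,0,0,0; 0,1,0,0; 0,0,-1,0; 0,0,0,-1],
    !![0,0,0,1; 0,0,1,0; 0,-1,0,0; -1,0,0,0],
    !![0,0,0,-I; 0,0,I,0; 0,I,0,0; -I,0,0,0],
    !![0,0,1,0; 0,0,0,-1; -1,0,0,0; 0,1,0,0]]

/-- γ⁵ = i·γ⁰γ¹γ²γ³. -/
def γ5 : Matrix (Fin 4) (Fin 4) ℂ := I • (γm 0 * γm 1 * γm 2 * γm 3)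

/-- σ^{μν} = (i/2)[γ^μ, γ^ν]. -/
def σm (μ ν : Fin 4) : Matrix (Fin 4) (Fin 4) ℂ := (I / 2) • (γm μ * γm ν - γm ν * γm μ)

/-- The metric signs ε 0 = 1, ε 1 = ε 2 = ε 3 = −1 used to raise/lower indices. -/
def εs : Fin 4 → ℤ := ![1, -1, -1, -1]

/-- The totally antisymmetric Levi-Civita symbol on four indices,
normalized by ε₄ 0 1 2 3 = 1. -/
def ε4 (κ l μ ν : Fin 4) : ℤ :=
  Matrix.det (Matrix.of fun p q : Fin 4 => if ![κ, l, μ, ν] p = q then (1 : ℤ) else 0)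

/-- The Grassmann algebra generated by the 8N fermion components:
the exterior algebra of the direct sum of two copies of (Fin 4 × Fin N) → ℂ. -/
abbrev GrassAlg (N : ℕ) :=
  ExteriorAlgebra ℂ (((Fin 4 × Fin N) → ℂ) × ((Fin 4 × Fin N) → ℂ))

/-- ψ (A, i): the image in the Grassmann algebra of the standard basis vector
of the first summand indexed by (A, i). -/
def ψv (N : ℕ) (A : Fin 4) (i : Fin N) : GrassAlg N :=
  ExteriorAlgebra.ι ℂ (Pi.single (A, i) 1, 0)

/-- ψ̄ (A, i): the image in the Grassmann algebra of the standard basis vector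
of the second summand indexed by (A, i). -/
def ψbar (N : ℕ) (A : Fin 4) (i : Fin N) : GrassAlg N :=
  ExteriorAlgebra.ι ℂ (0, Pi.single (A, i) 1)

/-- The fermion bilinear B Γ i j = ∑_{A,B} Γ A B · ψ̄ (A,i) ψ (B,j). -/
def Bgr (N : ℕ) (Γ : Matrix (Fin 4) (Fin 4) ℂ) (i j : Fin N) : GrassAlg N :=
  ∑ A : Fin 4, ∑ B : Fin 4, Γ A B • (ψbar N A i * ψv N B j)

/-- ⟪Γ, X⟫ = ∑_{i,j} X i j · B Γ i j, the bilinear with Dirac structure Γ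
and color structure X. -/
def pairing (N : ℕ) (Γ : Matrix (Fin 4) (Fin 4) ℂ)
    (X : Matrix (Fin N) (Fin N) ℂ) : GrassAlg N :=
  ∑ i : Fin N, ∑ j : Fin N, X i j • Bgr N Γ i j

/-- ⟪Γ⟫ = ⟪Γ, 1⟫, the color-singlet bilinear. -/
def sing (N : ℕ) (Γ : Matrix (Fin 4) (Fin 4) ℂ) : GrassAlg N := pairing N Γ 1

lemma γ5_eq : γ5 = !![0,0,1,0; 0,0,0,1; 1,0,0,0; 0,1,0,0] := by
  ext i j
  fin_cases i <;> fin_cases j <;>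
    simp [γ5, γm, Matrix.mul_apply, Fin.sum_univ_four]

lemma γ5m_eq (μ : Fin 4) : γ5 * γm μ =
  (![!![0,0,-1,0; 0,0,0,-1; 1,0,0,0; 0,1,0,0],
    !![0,-1,0,0; -1,0,0,0; 0,0,0,1; 0,0,1,0],
    !![0,I,0,0; -I,0,0,0; 0,0,0,-I; 0,0,I,0],
    !![-1,0,0,0; 0,1,0,0; 0,0,1,0; 0,0,0,-1]] : Fin 4 → Matrix (Fin 4) (Fin 4) ℂ) μ := by
  rw [γ5_eq]
  ext i j
  fin_cases μ <;> fin_cases i <;> fin_cases j <;>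
    simp [γm, Matrix.mul_apply, Fin.sum_univ_four]

lemma σm_self (μ : Fin 4) : σm μ μ = 0 := by simp [σm]
lemma σm_swap (μ ν : Fin 4) : σm μ ν = - σm ν μ := by
  simp only [σm, ← smul_neg, neg_sub]

lemma γm_mul (μ ν : Fin 4) (h : μ < ν) : γm ν * γm μ = - (γm μ * γm ν) := by
  ext i j
  fin_cases μ <;> fin_cases ν <;> first | (exfalso; revert h; decide) | skip
  all_goals
   fin_cases i <;> fin_cases j <;>
    simp [γm, Matrix.mul_apply, Fin.sum_univ_four]

lemma σm_lt (μ ν : Fin 4) (h : μ < ν) : σm μ ν = I • (γm μ * γm ν) := by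
  rw [σm, γm_mul μ ν h, sub_neg_eq_add, ← two_smul ℂ, smul_smul]
  congr 1; ring

lemma σ01 : σm 0 1 = !![0,0,0,I; 0,0,I,0; 0,I,0,0; I,0,0,0] := by
  rw [σm_lt _ _ (by decide)]; ext i j
  fin_cases i <;> fin_cases j <;> simp [γm, Matrix.mul_apply, Fin.sum_univ_four]
lemma σ02 : σm 0 2 = !![0,0,0,1; 0,0,-1,0; 0,1,0,0; -1,0,0,0] := by
  rw [σm_lt _ _ (by decide)]; ext i j
  fin_cases i <;> fin_cases j <;> simp [γm, Matrix.mul_apply, Fin.sum_univ_four]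
lemma σ03 : σm 0 3 = !![0,0,I,0; 0,0,0,-I; I,0,0,0; 0,-I,0,0] := by
  rw [σm_lt _ _ (by decide)]; ext i j
  fin_cases i <;> fin_cases j <;> simp [γm, Matrix.mul_apply, Fin.sum_univ_four]
lemma σ12 : σm 1 2 = !![1,0,0,0; 0,-1,0,0; 0,0,1,0; 0,0,0,-1] := by
  rw [σm_lt _ _ (by decide)]; ext i j
  fin_cases i <;> fin_cases j <;> simp [γm, Matrix.mul_apply, Fin.sum_univ_four]
lemma σ13 : σm 1 3 = !![0,I,0,0; -I,0,0,0; 0,0,0,I; 0,0,-I,0] := by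
  rw [σm_lt _ _ (by decide)]; ext i j
  fin_cases i <;> fin_cases j <;> simp [γm, Matrix.mul_apply, Fin.sum_univ_four]
lemma σ23 : σm 2 3 = !![0,1,0,0; 1,0,0,0; 0,0,0,1; 0,0,1,0] := by
  rw [σm_lt _ _ (by decide)]; ext i j
  fin_cases i <;> fin_cases j <;> simp [γm, Matrix.mul_apply, Fin.sum_univ_four]

lemma σ_sum (A B C D : Fin 4) : ∑ μ, ∑ ν, ((εs μ : ℂ) * (εs ν : ℂ)) * (σm μ ν A D * σm μ ν C B)
    = 2 * (-(σm 0 1 A D * σm 0 1 C B) - σm 0 2 A D * σm 0 2 C B - σm 0 3 A D * σm 0 3 C B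
      + σm 1 2 A D * σm 1 2 C B + σm 1 3 A D * σm 1 3 C B + σm 2 3 A D * σm 2 3 C B) := by
  simp only [Fin.sum_univ_four, σm_self, σm_swap 1 0, σm_swap 2 0, σm_swap 3 0, σm_swap 2 1,
    σm_swap 3 1, σm_swap 3 2, εs, Matrix.neg_apply, Matrix.zero_apply]
  simp
  ring

set_option linter.unusedSimpArgs false
set_option maxHeartbeats 2000000 in
lemma tensor_id (A B C D : Fin 4) :
    -(1/2 : ℂ) * (γ5 A B * γ5 C D) =
      (-(1 / 8) : ℂ) * ((1 : Matrix (Fin 4) (Fin 4) ℂ) A D * (1 : Matrix (Fin 4) (Fin 4) ℂ) C B)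
        + (1 / 8 : ℂ) * ∑ μ, (εs μ : ℂ) * (γm μ A D * γm μ C B)
        - (1 / 16 : ℂ) * ∑ μ, ∑ ν, ((εs μ : ℂ) * (εs ν : ℂ)) * (σm μ ν A D * σm μ ν C B)
        - (1 / 8 : ℂ) * ∑ μ, (εs μ : ℂ) * ((γ5 * γm μ) A D * (γ5 * γm μ) C B)
        - (1 / 8 : ℂ) * (γ5 A D * γ5 C B) := by
  rw [σ_sum]
  simp only [γ5m_eq]
  simp only [γ5_eq, σ01, σ02, σ03, σ12, σ13, σ23, Fin.sum_univ_four]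
  fin_cases A <;> fin_cases D <;> simp [εs, γm] <;>
    fin_cases B <;> fin_cases C <;> simp <;> norm_num

lemma completeness (N : ℕ) (hN : 2 ≤ N)
    (T : Fin (N ^ 2 - 1) → Matrix (Fin N) (Fin N) ℂ)
    (htr : ∀ a, (T a).trace = 0)
    (horth : ∀ a b, (T a * T b).trace = if a = b then (1 / 2 : ℂ) else 0) (i j k l : Fin N) :
    ∑ a, T a i j * T a k l = (1/2 : ℂ) * ((if i = l ∧ j = k then 1 else 0)
      - (1/(N:ℂ)) * ((1 : Matrix (Fin N) (Fin N) ℂ) i j * (1 : Matrix (Fin N) (Fin N) ℂ) k l)) := by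
  have hN0 : (N : ℂ) ≠ 0 := by
    have : N ≠ 0 := by omega
    exact_mod_cast this
  let P : Matrix (Option (Fin (N^2-1))) (Fin N × Fin N) ℂ :=
    fun o p => o.elim ((1/(N:ℂ)) * (1 : Matrix (Fin N) (Fin N) ℂ) p.1 p.2) (fun a => 2 * T a p.1 p.2)
  let Q : Matrix (Fin N × Fin N) (Option (Fin (N^2-1))) ℂ :=
    fun p o => o.elim ((1 : Matrix (Fin N) (Fin N) ℂ) p.2 p.1) (fun a => T a p.2 p.1)
  have key : ∀ X Y : Matrix (Fin N) (Fin N) ℂ,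
      ∑ p : Fin N × Fin N, X p.1 p.2 * Y p.2 p.1 = (X * Y).trace := by
    intro X Y
    simp [Fintype.sum_prod_type, Matrix.trace, Matrix.mul_apply]
  have hPQ : P * Q = 1 := by
    ext a b
    rw [Matrix.mul_apply]
    rcases a with _ | a <;> rcases b with _ | b <;>
      simp only [P, Q, Option.elim, mul_assoc, ← Finset.mul_sum, key]
    · simp [hN0]
    · simp [htr]
    · simp [htr]
    · rw [horth]
      by_cases h : a = b <;> simp [h, Matrix.one_apply]
  have hcard : Fintype.card (Option (Fin (N^2-1))) = Fintype.card (Fin N × Fin N) := by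
    simp only [Fintype.card_option, Fintype.card_fin, Fintype.card_prod]
    have : 0 < N^2 := by positivity
    rw [← sq]; omega
  have hQP : Q * P = 1 := (Matrix.mul_eq_one_comm_of_card_eq _ _ ℂ hcard).mp hPQ
  have h := congrFun (congrFun hQP (j, i)) (k, l)
  rw [Matrix.mul_apply, Fintype.sum_option] at h
  simp only [P, Q, Option.elim] at h
  have h2 : ∑ a, T a i j * (2 * T a k l) = 2 * ∑ a, T a i j * T a k l := by
    rw [Finset.mul_sum]; exact Finset.sum_congr rfl fun a _ => by ring
  rw [h2, Matrix.one_apply (i := (j, i))] at h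
  have h3 : ((j, i) = (k, l)) ↔ (i = l ∧ j = k) := by
    rw [Prod.mk.injEq]; tauto
  simp only [h3] at h
  linear_combination (1/2 : ℂ) * h

/-- color-singlet Dirac bilinear -/
def Sd (N : ℕ) (A D : Fin 4) : GrassAlg N := ∑ i : Fin N, ψbar N A i * ψv N D i

lemma sing_eq (N : ℕ) (Γ : Matrix (Fin 4) (Fin 4) ℂ) :
    sing N Γ = ∑ A, ∑ D, Γ A D • Sd N A D := by
  simp only [sing, pairing, Matrix.one_apply, ite_smul, one_smul, zero_smul,
    Finset.sum_ite_eq, Finset.mem_univ, if_true]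
  simp only [Bgr, Sd, Finset.smul_sum]
  rw [Finset.sum_comm]
  refine Finset.sum_congr rfl fun A _ => ?_
  rw [Finset.sum_comm]

lemma sing_sq (N : ℕ) (Γ : Matrix (Fin 4) (Fin 4) ℂ) :
    sing N Γ * sing N Γ =
      ∑ A, ∑ D, ∑ C, ∑ B, (Γ A D * Γ C B) • (Sd N A D * Sd N C B) := by
  rw [sing_eq]
  simp only [Finset.sum_mul_sum, smul_mul_smul_comm]
  refine Finset.sum_congr rfl fun A _ => ?_
  rw [Finset.sum_comm]

lemma ι_anti (N : ℕ) (x y : ((Fin 4 × Fin N) → ℂ) × ((Fin 4 × Fin N) → ℂ)) :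
    ExteriorAlgebra.ι ℂ x * ExteriorAlgebra.ι ℂ y
      = - (ExteriorAlgebra.ι ℂ y * ExteriorAlgebra.ι ℂ x) :=
  eq_neg_of_add_eq_zero_left (ExteriorAlgebra.ι_add_mul_swap x y)

lemma reorder (N : ℕ) (A B C D : Fin 4) (i j : Fin N) :
    (ψbar N A i * ψv N B j) * (ψbar N C j * ψv N D i)
      = - ((ψbar N A i * ψv N D i) * (ψbar N C j * ψv N B j)) := by
  have h1 : ψv N B j * ψbar N C j = - (ψbar N C j * ψv N B j) := ι_anti N _ _
  have h2 : ψv N B j * ψv N D i = - (ψv N D i * ψv N B j) := ι_anti N _ _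
  have h3 : ψbar N C j * ψv N D i = - (ψv N D i * ψbar N C j) := ι_anti N _ _
  calc _ = ψbar N A i * (ψv N B j * ψbar N C j) * ψv N D i := by simp only [mul_assoc]
    _ = - (ψbar N A i * (ψbar N C j * (ψv N B j * ψv N D i))) := by
        rw [h1]; simp only [mul_assoc, mul_neg, neg_mul]
    _ = ψbar N A i * ((ψbar N C j * ψv N D i) * ψv N B j) := by
        rw [h2]; simp only [mul_assoc, mul_neg, neg_neg]
    _ = _ := by rw [h3]; simp only [mul_assoc, mul_neg, neg_mul]

lemma exchange (N : ℕ) (Γ : Matrix (Fin 4) (Fin 4) ℂ) :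
    ∑ i, ∑ j, Bgr N Γ i j * Bgr N Γ j i =
      ∑ A, ∑ D, ∑ C, ∑ B, (-(Γ A B * Γ C D)) • (Sd N A D * Sd N C B) := by
  have hS : ∀ A D C B : Fin 4, Sd N A D * Sd N C B =
      ∑ i, ∑ j, (ψbar N A i * ψv N D i) * (ψbar N C j * ψv N B j) := by
    intro A D C B
    simp only [Sd, Finset.sum_mul, Finset.mul_sum]
    try rw [Finset.sum_comm]
  have hB : ∀ i j, Bgr N Γ i j * Bgr N Γ j i = ∑ A, ∑ D, ∑ C, ∑ B,
      (-(Γ A B * Γ C D)) • ((ψbar N A i * ψv N D i) * (ψbar N C j * ψv N B j)) := by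
    intro i j
    have : Bgr N Γ i j * Bgr N Γ j i = ∑ A, ∑ B, ∑ C, ∑ D,
      (-(Γ A B * Γ C D)) • ((ψbar N A i * ψv N D i) * (ψbar N C j * ψv N B j)) := by
      simp only [Bgr, Finset.sum_mul_sum]
      simp only [smul_mul_smul_comm, reorder, smul_neg, neg_smul]
      refine Finset.sum_congr rfl fun A _ => ?_
      rw [Finset.sum_comm]
    rw [this]
    refine Finset.sum_congr rfl fun A _ => ?_
    calc _ = ∑ B, ∑ D, ∑ C, _ := Finset.sum_congr rfl fun B _ => Finset.sum_comm
      _ = ∑ D, ∑ B, ∑ C, _ := Finset.sum_comm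
      _ = _ := Finset.sum_congr rfl fun B _ => Finset.sum_comm
  simp only [hB, hS, Finset.smul_sum]
  have push : ∀ f : Fin 4 → Fin N → Fin N → GrassAlg N,
      ∑ i, ∑ j, ∑ A, f A i j = ∑ A, ∑ i, ∑ j, f A i j := by
    intro f
    rw [Finset.sum_comm]
    calc _ = ∑ j, ∑ A, ∑ i, f A i j := Finset.sum_congr rfl fun B _ => Finset.sum_comm
      _ = ∑ A, ∑ j, ∑ i, f A i j := Finset.sum_comm
      _ = _ := Finset.sum_congr rfl fun B _ => Finset.sum_comm
  simp only [push]

lemma lhs_eq (N : ℕ) (hN : 2 ≤ N)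
    (T : Fin (N ^ 2 - 1) → Matrix (Fin N) (Fin N) ℂ)
    (htr : ∀ a, (T a).trace = 0)
    (horth : ∀ a b, (T a * T b).trace = if a = b then (1 / 2 : ℂ) else 0)
    (Γ : Matrix (Fin 4) (Fin 4) ℂ) :
    ∑ a, pairing N Γ (T a) * pairing N Γ (T a) =
      (1/2 : ℂ) • (∑ i, ∑ j, Bgr N Γ i j * Bgr N Γ j i)
        - (1/(2*(N:ℂ))) • (sing N Γ * sing N Γ) := by
  have hp : ∀ X : Matrix (Fin N) (Fin N) ℂ, pairing N Γ X * pairing N Γ X =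
      ∑ p : Fin N × Fin N, ∑ q : Fin N × Fin N,
        (X p.1 p.2 * X q.1 q.2) • (Bgr N Γ p.1 p.2 * Bgr N Γ q.1 q.2) := by
    intro X
    have : pairing N Γ X = ∑ p : Fin N × Fin N, X p.1 p.2 • Bgr N Γ p.1 p.2 := by
      rw [Fintype.sum_prod_type]; rfl
    rw [this, Finset.sum_mul_sum]
    simp only [smul_mul_smul_comm]
  have hx : ∑ i, ∑ j, Bgr N Γ i j * Bgr N Γ j i = ∑ p : Fin N × Fin N, ∑ q : Fin N × Fin N,
        (if p.1 = q.2 ∧ p.2 = q.1 then (1:ℂ) else 0) • (Bgr N Γ p.1 p.2 * Bgr N Γ q.1 q.2) := by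
    rw [Fintype.sum_prod_type]
    refine Finset.sum_congr rfl fun i _ => Finset.sum_congr rfl fun j _ => ?_
    rw [Finset.sum_eq_single (j, i)]
    · simp
    · rintro ⟨k, l⟩ - h
      rw [if_neg, zero_smul]
      rintro ⟨rfl, rfl⟩
      exact h rfl
    · simp
  rw [sing, hp 1, hx]
  simp only [hp]
  rw [Finset.sum_comm]
  simp only [Finset.smul_sum, ← Finset.sum_sub_distrib]
  refine Finset.sum_congr rfl fun p _ => ?_
  rw [Finset.sum_comm]
  refine Finset.sum_congr rfl fun q _ => ?_
  rw [← Finset.sum_smul, completeness N hN T htr horth, smul_smul, smul_smul, ← sub_smul]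
  congr 1
  ring

/-- **Pseudoscalar Fierz identity for U(N) fermions.** -/
theorem fierz_pseudoscalar (N : ℕ) (hN : 2 ≤ N)
    (T : Fin (N ^ 2 - 1) → Matrix (Fin N) (Fin N) ℂ)
    (htr : ∀ a, (T a).trace = 0)
    (hherm : ∀ a, (T a)ᴴ = T a)
    (horth : ∀ a b, (T a * T b).trace = if a = b then (1 / 2 : ℂ) else 0) :
    ∑ a, pairing N γ5 (T a) * pairing N γ5 (T a) =
      (-(1 / 8) : ℂ) • (sing N 1 * sing N 1)
        + (1 / 8 : ℂ) • ∑ μ, (εs μ : ℂ) • (sing N (γm μ) * sing N (γm μ))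
        - (1 / 16 : ℂ) • ∑ μ, ∑ ν, ((εs μ : ℂ) * (εs ν : ℂ)) •
            (sing N (σm μ ν) * sing N (σm μ ν))
        - (1 / 8 : ℂ) • ∑ μ, (εs μ : ℂ) • (sing N (γ5 * γm μ) * sing N (γ5 * γm μ))
        - (((N : ℂ) + 4) / (8 * (N : ℂ))) • (sing N γ5 * sing N γ5) := by
  rw [lhs_eq N hN T htr horth, exchange]
  have hN0 : (N : ℂ) ≠ 0 := by
    have : N ≠ 0 := by omega
    exact_mod_cast this
  have hc : (((N : ℂ) + 4) / (8 * (N : ℂ))) = 1/8 + 1/(2*(N:ℂ)) := by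
    field_simp; ring
  rw [hc, add_smul, ← sub_sub]
  congr 1
  simp only [sing_sq]
  have push : ∀ (c : Fin 4 → ℂ) (f : Fin 4 → Fin 4 → Fin 4 → Fin 4 → Fin 4 → ℂ),
      ∑ μ, c μ • (∑ A, ∑ D, ∑ C, ∑ B, f μ A D C B • (Sd N A D * Sd N C B)) =
      ∑ A, ∑ D, ∑ C, ∑ B, (∑ μ, c μ * f μ A D C B) • (Sd N A D * Sd N C B) := by
    intro c f
    simp only [Finset.smul_sum, smul_smul, Finset.sum_smul]
    rw [Finset.sum_comm]
    refine Finset.sum_congr rfl fun A _ => ?_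
    rw [Finset.sum_comm]
    refine Finset.sum_congr rfl fun D _ => ?_
    rw [Finset.sum_comm]
    refine Finset.sum_congr rfl fun C _ => ?_
    rw [Finset.sum_comm]
  have push1 : ∀ (f : Fin 4 → Fin 4 → Fin 4 → Fin 4 → Fin 4 → ℂ),
      ∑ μ, (∑ A, ∑ D, ∑ C, ∑ B, f μ A D C B • (Sd N A D * Sd N C B)) =
      ∑ A, ∑ D, ∑ C, ∑ B, (∑ μ, f μ A D C B) • (Sd N A D * Sd N C B) := by
    intro f
    simpa using push (fun _ => 1) f
  rw [push (fun μ => (εs μ : ℂ)) (fun μ A D C B => γm μ A D * γm μ C B),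
    push (fun μ => (εs μ : ℂ)) (fun μ A D C B => (γ5 * γm μ) A D * (γ5 * γm μ) C B)]
  have hσ : ∀ μ, ∑ ν, ((εs μ : ℂ) * (εs ν : ℂ)) •
      (∑ A, ∑ D, ∑ C, ∑ B, (σm μ ν A D * σm μ ν C B) • (Sd N A D * Sd N C B)) =
      ∑ A, ∑ D, ∑ C, ∑ B, (∑ ν, ((εs μ : ℂ) * (εs ν : ℂ)) * (σm μ ν A D * σm μ ν C B)) •
        (Sd N A D * Sd N C B) := fun μ =>
    push (fun ν => (εs μ : ℂ) * (εs ν : ℂ)) (fun ν A D C B => σm μ ν A D * σm μ ν C B)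
  simp only [hσ]
  rw [push1 (fun μ A D C B => ∑ ν, ((εs μ : ℂ) * (εs ν : ℂ)) * (σm μ ν A D * σm μ ν C B))]
  simp only [Finset.smul_sum (N := GrassAlg N), smul_smul, ← Finset.sum_add_distrib,
    ← Finset.sum_sub_distrib, ← add_smul, ← sub_smul]
  refine Finset.sum_congr rfl fun A _ => Finset.sum_congr rfl fun D _ =>
    Finset.sum_congr rfl fun C _ => Finset.sum_congr rfl fun B _ => ?_
  congr 1
  rw [← tensor_id]
  ring
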